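/- Let n > m > 0 be integers, β, δ ∈ {−1, 1}, t ≥ 1 an integer, and let λ ∈ ℂ be a primitive t-th root of unity satisfying λ^n + β·λ^m + δ = 0. Then: (a) if β = 1, t divides n + m and t divides 3(n − m); (b) if β = −1, t divides 2(n + m) and t divides 6(n − m). In particular, if 3 does not divide t, then in case (a) t ∈ {1, 2} and in case (b) t divides 4, so λ ∈ {1, −1, i, −i}. -/

import Mathlib

open Polynomial

/-- Three complex numbers of modulus one that sum to zero satisfy `a * b = c ^ 2`. -/
theorem Complex.mul_eq_sq_of_add_add_eq_zero {a b c : ℂ} (ha : ‖a‖ = 1) (hb : ‖b‖ = 1)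
    (hc : ‖c‖ = 1) (h : a + b + c = 0) : a * b = c ^ 2 := by
  have ha0 : a ≠ 0 := norm_ne_zero_iff.mp (by simp [ha])
  have hb0 : b ≠ 0 := norm_ne_zero_iff.mp (by simp [hb])
  have hc0 : c ≠ 0 := norm_ne_zero_iff.mp (by simp [hc])
  have hinv : a⁻¹ + b⁻¹ + c⁻¹ = 0 := by
    rw [Complex.inv_eq_conj ha, Complex.inv_eq_conj hb, Complex.inv_eq_conj hc, ← map_add,
      ← map_add, h, map_zero]
  field_simp at hinv
  linear_combination hinv - c * h

/-- Roots of unity of trinomials: let `n > m > 0`, `β, δ ∈ {−1, 1}`, `t ≥ 1`, and let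
`λ ∈ ℂ` be a primitive `t`-th root of unity with `λ^n + β·λ^m + δ = 0`.  Then:
(a) if `β = 1`, then `t ∣ n + m` and `t ∣ 3(n − m)`;
(b) if `β = −1`, then `t ∣ 2(n + m)` and `t ∣ 6(n − m)`.
In particular, if `3 ∤ t`, then in case (a) `t ∈ {1, 2}`, in case (b) `t ∣ 4`, and
`λ ∈ {1, −1, i, −i}`. -/
theorem trinomial_root_of_unity (n m : ℕ) (hm : 0 < m) (hnm : m < n)
    (t : ℕ) (ht : 1 ≤ t)
    (β δ : ℂ) (hβ : β = 1 ∨ β = -1) (hδ : δ = 1 ∨ δ = -1)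
    (lam : ℂ) (hlam : IsPrimitiveRoot lam t)
    (hroot : lam ^ n + β * lam ^ m + δ = 0) :
    (β = 1 → t ∣ (n + m) ∧ t ∣ 3 * (n - m)) ∧
    (β = -1 → t ∣ 2 * (n + m) ∧ t ∣ 6 * (n - m)) ∧
    (¬ (3 ∣ t) →
      (β = 1 → t = 1 ∨ t = 2) ∧ (β = -1 → t ∣ 4) ∧
      (lam = 1 ∨ lam = -1 ∨ lam = Complex.I ∨ lam = -Complex.I)) := by
  have hnorm (k : ℕ) : ‖lam ^ k‖ = 1 := by
    rw [norm_pow, hlam.norm'_eq_one (by omega), one_pow]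
  have hδ2 : δ ^ 2 = 1 := by rcases hδ with rfl | rfl <;> norm_num
  have hβ2 : β ^ 2 = 1 := by rcases hβ with rfl | rfl <;> norm_num
  have hβm : ‖β * lam ^ m‖ = 1 := by rcases hβ with rfl | rfl <;> simp [-norm_pow, hnorm]
  have hprod : lam ^ n * (β * lam ^ m) = 1 :=
    (Complex.mul_eq_sq_of_add_add_eq_zero (hnorm n) hβm
      (by rcases hδ with rfl | rfl <;> simp) hroot).trans hδ2
  have hsum : (lam ^ n + β * lam ^ m) ^ 2 = 1 := by
    rw [eq_neg_of_add_eq_zero_left hroot, neg_sq, hδ2]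
  obtain ⟨d, rfl⟩ := Nat.exists_eq_add_of_lt hnm
  have hm0 : lam ^ m ≠ 0 := norm_ne_zero_iff.mp (by simp [hnorm])
  rw [show m + d + 1 - m = d + 1 by omega]
  rw [show m + d + 1 = m + (d + 1) by omega, pow_add] at hprod hsum
  rw [show m + d + 1 + m = m + (d + 1) + m by omega]
  have hadd : lam ^ (m + (d + 1) + m) = β := by
    rw [pow_add, pow_add]
    linear_combination β * hprod - lam ^ m * lam ^ (d + 1) * lam ^ m * hβ2
  have hsq : (lam ^ (d + 1)) ^ 2 + β * lam ^ (d + 1) + 1 = 0 := by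
    apply (mul_eq_zero.mp _).resolve_left (pow_ne_zero 2 hm0)
    linear_combination hsum - hprod - (lam ^ m) ^ 2 * hβ2
  have hcube : (lam ^ (d + 1)) ^ 3 = β := by
    linear_combination (lam ^ (d + 1) - β) * hsq + lam ^ (d + 1) * hβ2
  have hdvd_sub : t ∣ 6 * (d + 1) := by
    apply hlam.dvd_of_pow_eq_one
    rw [show 6 * (d + 1) = (d + 1) * 3 * 2 by ring, pow_mul, pow_mul, hcube, hβ2]
  refine ⟨fun h => ⟨hlam.dvd_of_pow_eq_one _ (hadd.trans h), hlam.dvd_of_pow_eq_one _ ?_⟩,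
    fun _ => ⟨hlam.dvd_of_pow_eq_one _ ?_, hdvd_sub⟩, fun h3 => False.elim ?_⟩
  · rw [mul_comm, pow_mul, hcube, h]
  · rw [mul_comm, pow_mul, hadd, hβ2]
  · have hcop : Nat.Coprime t 3 := ((Nat.Prime.coprime_iff_not_dvd Nat.prime_three).mpr h3).symm
    have hdvd : t ∣ (d + 1) * 2 := hcop.dvd_of_dvd_mul_left (by convert hdvd_sub using 1; ring)
    have hone : (lam ^ (d + 1)) ^ 2 = 1 := by
      rw [← pow_mul]; exact (hlam.pow_eq_one_iff_dvd _).mpr hdvd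
    have htwo : lam ^ (d + 1) * β = -2 := by linear_combination hsq - hone
    have hfour : (1 : ℂ) = 4 := by
      linear_combination (lam ^ (d + 1) * β - 2) * htwo - β ^ 2 * hone - hβ2
    norm_num at hfour
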